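/- arXiv:1610.04498 — 2 statements merged into one kernel-verified Lean document; each statement's English description precedes it below -/
import Mathlib

section
/- For every selection vector s ∈ 𝒮, every ordering vector π ∈ Π(s), and every prefix length 1 ≤ t ≤ k, Σ_{i=1}^t a_i(π) ≤ Σ_{i=1}^t a_i(π_v(s)); that is, the vertical ordering vector maximizes every prefix sum of the sequence a_i. -/
open Finset

/-- Number of earlier occurrences of the same cluster: `#{ j < i : π j = π i }`. -/
def repCount {L k : ℕ} (π : Fin k → Fin L) (i : Fin k) : ℕ :=
  (Finset.univ.filter fun j => j < i ∧ π j = π i).card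

/-- `a_i(π) = n_I − 1 − #{ j < i : π j = π i }`. -/
def aSeq (nI : ℕ) {L k : ℕ} (π : Fin k → Fin L) (i : Fin k) : ℤ :=
  (nI : ℤ) - 1 - (repCount π i : ℤ)

/-- The `i`-th weight value `ω_i(π) = a_i(π) β_I + (n − i − a_i(π)) β_c`
(here `i : Fin k` represents the 1-indexed position `i+1`). -/
def wSeq (n nI : ℕ) (βI βc : ℝ) {L k : ℕ} (π : Fin k → Fin L) (i : Fin k) : ℝ :=
  (aSeq nI π i : ℝ) * βI + ((n : ℝ) - ((i : ℕ) + 1) - (aSeq nI π i : ℝ)) * βc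

/-- Min-cut value `c_min(s, π) = Σ_{i=1}^k min(ω_i(π), α)`. -/
def cminVal (n nI : ℕ) (βI βc α : ℝ) {L k : ℕ} (π : Fin k → Fin L) : ℝ :=
  ∑ i, min (wSeq n nI βI βc π i) α

/-- `s` is a selection vector: entries bounded by `n_I`, nonincreasing, summing to `k`. -/
def IsSelection (nI k : ℕ) {L : ℕ} (s : Fin L → ℕ) : Prop :=
  (∀ i, s i ≤ nI) ∧ (∀ i j : Fin L, i ≤ j → s j ≤ s i) ∧ ∑ i, s i = k

/-- `π` is an ordering vector for `s`: for each cluster `l`, exactly `s l` entries equal `l`. -/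
def IsOrdering {L k : ℕ} (s : Fin L → ℕ) (π : Fin k → Fin L) : Prop :=
  ∀ l, (Finset.univ.filter fun i => π i = l).card = s l

/-- The vertical ordering vector `π_v(s)`: concatenation over rounds `r = 0, 1, …` of the
clusters `l` with `s l > r`, listed in increasing order (Algorithm 1). -/
def verticalOrdering {L : ℕ} (hL : 0 < L) (k : ℕ) (s : Fin L → ℕ) : Fin k → Fin L :=
  fun i =>
    ((List.range k).flatMap fun r => (List.finRange L).filter fun l => r < s l).getD i.1 ⟨0, hL⟩

/-- The horizontal selection vector `s_h` (0-indexed clusters). -/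
def horizontalSel (L nI k : ℕ) : Fin L → ℕ :=
  fun i => if (i : ℕ) < k / nI then nI else if (i : ℕ) = k / nI then k % nI else 0

/-- A strictly earlier position with the same cluster has a strictly smaller repetition count. -/
theorem repCount_lt_repCount {L k : ℕ} (π : Fin k → Fin L) {i j : Fin k} (hij : i < j)
    (h : π i = π j) : repCount π i < repCount π j := by
  refine Finset.card_lt_card (Finset.ssubset_iff_of_subset ?_ |>.2 ⟨i, ?_, ?_⟩)
  · intro x hx
    simp only [mem_filter, mem_univ, true_and] at hx ⊢
    exact ⟨hx.1.trans hij, hx.2.trans h⟩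
  · simp [hij, h]
  · simp

theorem repCount_lt_of_isOrdering {L k : ℕ} {s : Fin L → ℕ} {π : Fin k → Fin L}
    (hπ : IsOrdering s π) (i : Fin k) : repCount π i < s (π i) := by
  rw [← hπ (π i)]
  refine Finset.card_lt_card (Finset.ssubset_iff_of_subset ?_ |>.2 ⟨i, ?_, ?_⟩)
  · intro x hx
    simp only [mem_filter, mem_univ, true_and] at hx ⊢
    exact hx.2
  · simp
  · simp

/-- An ordering vector together with its repetition counts never repeats a pair. -/
theorem pair_repCount_injective {L k : ℕ} (π : Fin k → Fin L) :
    Function.Injective fun i => (π i, repCount π i) := by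
  intro i j h
  obtain ⟨h₁, h₂⟩ := Prod.mk.inj h
  rcases lt_trichotomy i j with hij | hij | hij
  · exact absurd h₂ (repCount_lt_repCount π hij h₁).ne
  · exact hij
  · exact absurd h₂.symm (repCount_lt_repCount π hij h₁.symm).ne

/-- The cells `(l, r)` with `r < s l`, listed round by round. -/
def cellList {L : ℕ} (k : ℕ) (s : Fin L → ℕ) : List (Fin L × ℕ) :=
  (List.range k).flatMap fun r => ((List.finRange L).filter fun l => r < s l).map fun l => (l, r)

theorem map_fst_cellList {L : ℕ} (k : ℕ) (s : Fin L → ℕ) :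
    (cellList k s).map Prod.fst =
      (List.range k).flatMap fun r => (List.finRange L).filter fun l => r < s l := by
  simp [cellList, List.map_flatMap, Function.comp_def]

theorem mem_cellList {L k : ℕ} {s : Fin L → ℕ} {p : Fin L × ℕ} :
    p ∈ cellList k s ↔ p.2 < k ∧ p.2 < s p.1 := by
  obtain ⟨l, r⟩ := p
  simp [cellList]

theorem pairwise_cellList {L : ℕ} (k : ℕ) (s : Fin L → ℕ) :
    (cellList k s).Pairwise fun p q => p.2 < q.2 ∨ p.2 = q.2 ∧ p.1 < q.1 := by
  rw [cellList, List.pairwise_flatMap]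
  constructor
  · intro r _
    rw [List.pairwise_map]
    exact ((List.pairwise_lt_finRange L).filter _).imp fun h => Or.inr ⟨rfl, h⟩
  · refine List.pairwise_lt_range.imp fun h => ?_
    simp only [List.mem_map]
    rintro _ ⟨_, _, rfl⟩ _ ⟨_, _, rfl⟩
    exact Or.inl h

theorem nodup_cellList {L : ℕ} (k : ℕ) (s : Fin L → ℕ) : (cellList k s).Nodup :=
  (pairwise_cellList k s).imp fun {p q} h => by
    rintro rfl
    simp at h

theorem length_cellList {L k : ℕ} {s : Fin L → ℕ} (hs : ∑ l, s l = k) :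
    (cellList k s).length = k := by
  have hle : ∀ l, s l ≤ k := fun l =>
    hs ▸ Finset.single_le_sum (fun _ _ => Nat.zero_le _) (Finset.mem_univ l)
  rw [← List.toFinset_card_of_nodup (nodup_cellList k s), ← hs,
    Finset.card_eq_sum_card_fiberwise (f := Prod.fst) (t := Finset.univ) (by simp)]
  refine Finset.sum_congr rfl fun l _ => ?_
  rw [← Finset.card_range (s l)]
  symm
  refine Finset.card_bij (fun r _ => (l, r)) ?_ ?_ ?_
  · intro r hr
    have := hle l
    simp only [mem_range] at hr
    simp only [mem_filter, List.mem_toFinset, mem_cellList, and_true]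
    omega
  · intro a _ b _ h
    exact (Prod.mk.inj h).2
  · rintro ⟨m, r⟩ hp
    simp only [mem_filter, List.mem_toFinset, mem_cellList] at hp
    obtain ⟨⟨_, h⟩, rfl⟩ := hp
    exact ⟨r, by simpa using h, rfl⟩

/-- In the vertical ordering, the repetition count at a position is the round it belongs to. -/
theorem pair_verticalOrdering {L k : ℕ} (hL : 0 < L) {s : Fin L → ℕ} (hs : ∑ l, s l = k)
    (i : Fin k) :
    (verticalOrdering hL k s i, repCount (verticalOrdering hL k s) i) =
      (cellList k s)[(i : ℕ)]'((length_cellList hs).symm ▸ i.2) := by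
  have hlen := length_cellList hs
  have hv : ∀ j : Fin k,
      verticalOrdering hL k s j = ((cellList k s)[(j : ℕ)]'(hlen.symm ▸ j.2)).1 := by
    intro j
    rw [verticalOrdering, ← map_fst_cellList, List.getD_eq_getElem _ _ (by simp [hlen])]
    simp
  have hpw := List.pairwise_iff_getElem.1 (pairwise_cellList k s)
  refine Prod.ext (hv i) ?_
  change repCount _ i = _
  have hi : (i : ℕ) < (cellList k s).length := hlen.symm ▸ i.2
  rw [repCount, ← Finset.card_range ((cellList k s)[(i : ℕ)]).2]
  refine Finset.card_bij (fun j _ => ((cellList k s)[(j : ℕ)]'(hlen.symm ▸ j.2)).2) ?_ ?_ ?_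
  · intro j hj
    simp only [mem_filter, mem_univ, true_and, hv] at hj
    rcases hpw j i (hlen.symm ▸ j.2) hi hj.1 with h | h
    · simpa using h
    · exact absurd hj.2 h.2.ne
  · intro a ha b hb hab
    simp only [mem_filter, mem_univ, true_and, hv] at ha hb
    have := (nodup_cellList k s).getElem_inj_iff.1 (Prod.ext (ha.2.trans hb.2.symm) hab)
    exact Fin.ext this
  · intro r hr
    simp only [mem_range] at hr
    have hmi := mem_cellList.1 (List.getElem_mem hi)
    have hm : (((cellList k s)[(i : ℕ)]).1, r) ∈ cellList k s :=
      mem_cellList.2 ⟨hr.trans hmi.1, hr.trans hmi.2⟩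
    obtain ⟨j, hj, hje⟩ := List.getElem_of_mem hm
    refine ⟨⟨j, hlen ▸ hj⟩, ?_, by simp [hje]⟩
    simp only [mem_filter, mem_univ, true_and, hv, hje, and_true]
    rw [Fin.lt_def]
    by_contra hcon
    rcases (not_lt.1 hcon).eq_or_lt with h | h
    · simp only at h
      subst h
      rw [hje] at hr
      exact lt_irrefl _ hr
    · rcases hpw i j hi hj h with h | h
      · rw [hje] at h
        exact lt_asymm h hr
      · rw [hje] at h
        exact lt_irrefl _ h.2

theorem repCount_verticalOrdering_mono {L k : ℕ} (hL : 0 < L) {s : Fin L → ℕ}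
    (hs : ∑ l, s l = k) : Monotone (repCount (verticalOrdering hL k s)) := by
  have hlen := length_cellList hs
  refine monotone_iff_forall_lt.2 fun i j hij => ?_
  have h := List.pairwise_iff_getElem.1 (pairwise_cellList k s) i j (hlen.symm ▸ i.2)
    (hlen.symm ▸ j.2) hij
  rw [← pair_verticalOrdering hL hs i, ← pair_verticalOrdering hL hs j] at h
  rcases h with h | h
  · exact h.le
  · exact h.1.le

/-- An initial segment minimizes the sum of a monotone function among sets of its size. -/
theorem sum_initial_le_sum_of_card_eq {k : ℕ} {f : Fin k → ℕ} (hf : Monotone f) (t : ℕ)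
    {S : Finset (Fin k)} (hS : (Finset.univ.filter fun i : Fin k => (i : ℕ) < t).card = S.card) :
    ∑ i ∈ Finset.univ.filter (fun i : Fin k => (i : ℕ) < t), f i ≤ ∑ i ∈ S, f i := by
  set A := Finset.univ.filter fun i : Fin k => (i : ℕ) < t with hA
  have hcard : (A \ S).card = (S \ A).card := Finset.card_sdiff_comm hS
  rw [← Finset.sum_sdiff_le_sum_sdiff]
  have hle : ∀ a ∈ A \ S, ∀ b ∈ S \ A, f a ≤ f b := by
    intro a ha b hb
    simp only [hA, mem_sdiff, mem_filter, mem_univ, true_and] at ha hb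
    exact hf (Fin.le_def.2 (by omega))
  calc ∑ i ∈ A \ S, f i ≤ (A \ S).card • (A \ S).sup f :=
        Finset.sum_le_card_nsmul _ _ _ fun a ha => Finset.le_sup ha
    _ = (S \ A).card • (A \ S).sup f := by rw [hcard]
    _ ≤ ∑ i ∈ S \ A, f i :=
        Finset.card_nsmul_le_sum _ _ _ fun b hb => Finset.sup_le fun a ha => hle a ha b hb

/-- Every ordering vector is matched injectively with positions of the vertical one having the
same repetition count. -/
theorem exists_injective_repCount_eq {L k : ℕ} (hL : 0 < L) {s : Fin L → ℕ}
    (hs : ∑ l, s l = k) {π : Fin k → Fin L} (hπ : IsOrdering s π) :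
    ∃ σ : Fin k → Fin k, Function.Injective σ ∧
      ∀ i, repCount (verticalOrdering hL k s) (σ i) = repCount π i := by
  have hex : ∀ i, ∃ j : Fin k,
      (verticalOrdering hL k s j, repCount (verticalOrdering hL k s) j) =
        (π i, repCount π i) := by
    intro i
    have hlt := repCount_lt_of_isOrdering hπ i
    have hle : s (π i) ≤ k :=
      hs ▸ Finset.single_le_sum (fun _ _ => Nat.zero_le _) (Finset.mem_univ (π i))
    have hm : (π i, repCount π i) ∈ cellList k s := mem_cellList.2 ⟨hlt.trans_le hle, hlt⟩
    obtain ⟨j, hj, hje⟩ := List.getElem_of_mem hm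
    exact ⟨⟨j, length_cellList hs ▸ hj⟩, by rw [pair_verticalOrdering hL hs, ← hje]⟩
  choose σ hσ using hex
  refine ⟨σ, fun i j hij => pair_repCount_injective π ?_, fun i => (Prod.mk.inj (hσ i)).2⟩
  simp only [← hσ, hij]

/-- For every selection vector `s ∈ 𝒮`, every ordering vector `π ∈ Π(s)` and every
`1 ≤ t ≤ k`, `Σ_{i=1}^t a_i(π) ≤ Σ_{i=1}^t a_i(π_v(s))`: the vertical ordering vector
maximizes every prefix sum of the sequence `a_i`. -/
theorem vertical_maximizes_prefix_sums_a
    (n L k nI : ℕ) (hL : 1 ≤ L) (hn : n = L * nI) (hnI : 2 ≤ nI)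
    (hk1 : 1 ≤ k) (hkn : k ≤ n)
    (s : Fin L → ℕ) (hs : IsSelection nI k s)
    (π : Fin k → Fin L) (hπ : IsOrdering s π) :
    ∀ t : ℕ, 1 ≤ t → t ≤ k →
      ∑ i ∈ Finset.univ.filter (fun i : Fin k => (i : ℕ) < t), aSeq nI π i ≤
        ∑ i ∈ Finset.univ.filter (fun i : Fin k => (i : ℕ) < t),
          aSeq nI (verticalOrdering hL k s) i := by
  intro t _ _
  obtain ⟨σ, hσ, hrep⟩ := exists_injective_repCount_eq hL hs.2.2 hπ
  have key := sum_initial_le_sum_of_card_eq (repCount_verticalOrdering_mono hL hs.2.2) t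
    (S := (Finset.univ.filter fun i : Fin k => (i : ℕ) < t).image σ)
    (Finset.card_image_of_injective _ hσ).symm
  rw [Finset.sum_image hσ.injOn] at key
  simp only [hrep] at key
  simp only [aSeq, Finset.sum_sub_distrib]
  exact sub_le_sub_left (by exact_mod_cast key) _
end

section
/- For every selection vector s ∈ 𝒮 and every index 1 ≤ i ≤ k, the weights under the horizontal selection vector with vertical ordering are dominated pointwise: ω_i(π_v(s_h)) ≤ ω_i(π_v(s)). (Intermediate claim in the proof of Lemma 2.) -/
open Finset

/-- The clusters that still receive a node in round `r`, in increasing order. -/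
def roundList {L : ℕ} (s : Fin L → ℕ) (r : ℕ) : List (Fin L) :=
  (List.finRange L).filter fun l => r < s l

/-- The concatenation of the first `m` rounds. -/
def roundsList {L : ℕ} (s : Fin L → ℕ) (m : ℕ) : List (Fin L) :=
  (List.range m).flatMap (roundList s)

theorem nodup_roundList {L : ℕ} (s : Fin L → ℕ) (r : ℕ) : (roundList s r).Nodup :=
  (List.nodup_finRange L).filter _

theorem mem_roundList {L : ℕ} {s : Fin L → ℕ} {r : ℕ} {l : Fin L} :
    l ∈ roundList s r ↔ r < s l := by
  simp [roundList]

theorem length_roundList {L : ℕ} (s : Fin L → ℕ) (r : ℕ) :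
    (roundList s r).length = ∑ l, if r < s l then 1 else 0 := by
  rw [← List.toFinset_card_of_nodup (nodup_roundList s r), ← Finset.card_filter]
  congr 1
  ext l
  simp [mem_roundList]

theorem roundsList_succ {L : ℕ} (s : Fin L → ℕ) (m : ℕ) :
    roundsList s (m + 1) = roundsList s m ++ roundList s m := by
  simp [roundsList, List.range_succ]

theorem length_roundsList {L : ℕ} (s : Fin L → ℕ) (m : ℕ) :
    (roundsList s m).length = ∑ l, min (s l) m := by
  induction m with
  | zero => simp [roundsList]
  | succ m ih =>
    rw [roundsList_succ, List.length_append, ih, length_roundList, ← Finset.sum_add_distrib]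
    refine Finset.sum_congr rfl fun l _ => ?_
    split_ifs <;> omega

theorem roundsList_prefix {L : ℕ} (s : Fin L → ℕ) {m m' : ℕ} (h : m ≤ m') :
    roundsList s m <+: roundsList s m' := by
  induction m', h using Nat.le_induction with
  | base => exact List.prefix_rfl
  | succ m' _ ih =>
    rw [roundsList_succ]
    exact ih.trans (List.prefix_append _ _)

theorem count_roundsList {L : ℕ} (s : Fin L → ℕ) {m : ℕ} {l : Fin L} (h : m ≤ s l) :
    (roundsList s m).count l = m := by
  induction m with
  | zero => simp [roundsList]
  | succ m ih =>
    rw [roundsList_succ, List.count_append, ih (by omega),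
      List.count_eq_one_of_mem (nodup_roundList s m) (mem_roundList.2 (by omega))]

theorem card_filter_getD_eq_count_take {α : Type*} [DecidableEq α] (T : List α) (d x : α) {m : ℕ}
    (hm : m ≤ T.length) :
    ((Finset.range m).filter fun j => T.getD j d = x).card = (T.take m).count x := by
  induction m with
  | zero => simp
  | succ m ih =>
    have hm' : m < T.length := hm
    rw [Finset.range_add_one, Finset.filter_insert, List.take_succ_eq_append_getElem hm',
      List.count_append, ← ih hm'.le, List.getD_eq_getElem _ _ hm']
    split_ifs with hx
    · rw [Finset.card_insert_of_notMem (by simp)]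
      simp [hx]
    · simp [hx]

theorem repCount_getD {L k : ℕ} (T : List (Fin L)) (d : Fin L) (i : Fin k)
    (hi : (i : ℕ) < T.length) :
    repCount (fun j : Fin k => T.getD j.1 d) i = (T.take i).count (T[(i : ℕ)]) := by
  rw [← card_filter_getD_eq_count_take T d _ hi.le, repCount,
    ← Finset.card_map Fin.valEmbedding]
  congr 1
  ext j
  simp only [Finset.mem_map, Finset.mem_filter, Finset.mem_univ, true_and,
    Fin.valEmbedding_apply, Finset.mem_range, List.getD_eq_getElem _ _ hi]
  constructor
  · rintro ⟨j, ⟨hj, h⟩, rfl⟩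
    exact ⟨hj, h⟩
  · rintro ⟨hj, h⟩
    exact ⟨⟨j, hj.trans i.2⟩, ⟨hj, h⟩, rfl⟩

/-- The number of earlier repetitions at position `i` of the vertical ordering is the index of the
round containing `i`. -/
theorem repCount_verticalOrdering {L k : ℕ} (hL : 0 < L) (s : Fin L → ℕ) (i : Fin k) {r : ℕ}
    (hr : r < k) (h₁ : ∑ l, min (s l) r ≤ i) (h₂ : (i : ℕ) < ∑ l, min (s l) (r + 1)) :
    repCount (verticalOrdering hL k s) i = r := by
  obtain ⟨t, ht⟩ := roundsList_prefix s (Nat.succ_le_of_lt hr)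
  rw [Nat.succ_eq_add_one, roundsList_succ, List.append_assoc] at ht
  rw [← length_roundsList] at h₁ h₂
  rw [roundsList_succ, List.length_append] at h₂
  have hi : (i : ℕ) < (roundsList s k).length := by
    rw [← ht, List.length_append, List.length_append]
    omega
  have hj : (i : ℕ) - (roundsList s r).length < (roundList s r).length := by omega
  have hx : (roundsList s k)[(i : ℕ)] =
      (roundList s r)[(i : ℕ) - (roundsList s r).length] := by
    simp only [← ht]
    rw [List.getElem_append_right h₁, List.getElem_append_left hj]
  have hmem := List.getElem_mem hj
  have htake : (roundsList s k).take i =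
      roundsList s r ++ (roundList s r).take ((i : ℕ) - (roundsList s r).length) := by
    rw [← ht, List.take_append, List.take_of_length_le h₁, List.take_append_of_le_length hj.le]
  have hnot : (roundList s r)[(i : ℕ) - (roundsList s r).length] ∉
      (roundList s r).take ((i : ℕ) - (roundsList s r).length) := by
    intro hmem'
    obtain ⟨a, ha, hab⟩ := List.mem_take_iff_getElem.1 hmem'
    have := (nodup_roundList s r).getElem_inj_iff.1 hab
    omega
  refine (repCount_getD (roundsList s k) ⟨0, hL⟩ i hi).trans ?_
  rw [hx, htake, List.count_append, count_roundsList s (mem_roundList.1 hmem).le,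
    List.count_eq_zero_of_not_mem hnot, Nat.add_zero]

theorem exists_round {L k : ℕ} (s : Fin L → ℕ) {i : ℕ} (hi : i < ∑ l, min (s l) k) :
    ∃ r < k, ∑ l, min (s l) r ≤ i ∧ i < ∑ l, min (s l) (r + 1) := by
  induction k with
  | zero => simp at hi
  | succ k ih =>
    by_cases h : i < ∑ l, min (s l) k
    · obtain ⟨r, hr, h'⟩ := ih h
      exact ⟨r, hr.trans k.lt_succ_self, h'⟩
    · exact ⟨k, k.lt_succ_self, not_lt.1 h, hi⟩

theorem sum_min_horizontalSel {L nI k : ℕ} (hk : k ≤ L * nI) (r : ℕ) :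
    ∑ l, min (horizontalSel L nI k l) r = k / nI * min nI r + min (k % nI) r := by
  have key (q t M : ℕ) :
      ∑ l ∈ Finset.range M, min (if l < q then nI else if l = q then t else 0) r =
        min M q * min nI r + if q < M then min t r else 0 := by
    induction M with
    | zero => simp
    | succ M ih =>
      rw [Finset.sum_range_succ, ih]
      rcases lt_trichotomy M q with h | rfl | h
      · simp [h, h.le, Nat.succ_le_of_lt h, h.not_gt, (Nat.succ_le_of_lt h).not_gt, add_mul]
      · simp
      · simp [h, h.le, h.not_gt, h.ne', h.trans M.lt_succ_self, (h.trans M.lt_succ_self).le]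
  have hq : k / nI ≤ L := Nat.div_le_of_le_mul (by rwa [mul_comm])
  have hsum := key (k / nI) (k % nI) L
  rw [Finset.sum_range] at hsum
  refine hsum.trans ?_
  rw [min_eq_right hq]
  split_ifs with h
  · rfl
  · have hL : L = k / nI := by omega
    have := Nat.div_add_mod k nI
    rw [hL, mul_comm] at hk
    have : k % nI = 0 := by omega
    simp [this]

theorem div_mul_min_add_le {nI : ℕ} (hnI : 0 < nI) (r a x : ℕ) (hx : x ≤ nI) :
    (a + x) / nI * min nI r + min ((a + x) % nI) r ≤
      a / nI * min nI r + min (a % nI) r + min x r := by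
  have ha := Nat.div_add_mod a nI
  have ht := Nat.mod_lt a hnI
  by_cases h : a % nI + x < nI
  · have e : a + x = a % nI + x + nI * (a / nI) := by omega
    rw [e, Nat.add_mul_div_left _ _ hnI, Nat.add_mul_mod_self_left, Nat.div_eq_of_lt h,
      Nat.mod_eq_of_lt h, zero_add]
    omega
  · have e : a + x = a % nI + x - nI + nI * (a / nI + 1) := by rw [mul_add]; omega
    have h' : a % nI + x - nI < nI := by omega
    rw [e, Nat.add_mul_div_left _ _ hnI, Nat.add_mul_mod_self_left, Nat.div_eq_of_lt h',
      Nat.mod_eq_of_lt h', zero_add, add_mul]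
    omega

theorem div_mul_min_le_sum_min {ι : Type*} {nI : ℕ} (hnI : 0 < nI) (r : ℕ) (S : Finset ι)
    (s : ι → ℕ) (hs : ∀ i, s i ≤ nI) :
    (∑ i ∈ S, s i) / nI * min nI r + min ((∑ i ∈ S, s i) % nI) r ≤ ∑ i ∈ S, min (s i) r := by
  induction S using Finset.cons_induction with
  | empty => simp
  | cons i S hi ih =>
    rw [Finset.sum_cons, Finset.sum_cons, add_comm (s i), add_comm (min (s i) r)]
    exact (div_mul_min_add_le hnI r _ _ (hs i)).trans (Nat.add_le_add_right ih _)

theorem wSeq_le_wSeq_of_repCount_le {n nI L k : ℕ} {βI βc : ℝ} (hβ : βc ≤ βI)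
    {π π' : Fin k → Fin L} {i : Fin k} (h : repCount π' i ≤ repCount π i) :
    wSeq n nI βI βc π i ≤ wSeq n nI βI βc π' i := by
  have h' : (repCount π' i : ℝ) ≤ repCount π i := by exact_mod_cast h
  simp only [wSeq, aSeq]
  push_cast
  nlinarith [mul_nonneg (sub_nonneg.2 h') (sub_nonneg.2 hβ)]

/-- For every selection vector `s ∈ 𝒮` and every index `1 ≤ i ≤ k`, the weights under the
horizontal selection vector with vertical ordering are dominated pointwise:
`ω_i(π_v(s_h)) ≤ ω_i(π_v(s))`. -/
theorem horizontal_weights_dominated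
    (n L k nI : ℕ) (hL : 1 ≤ L) (hn : n = L * nI) (hnI : 2 ≤ nI)
    (hk1 : 1 ≤ k) (hkn : k ≤ n)
    (βI βc : ℝ) (hβc : 0 ≤ βc) (hβIc : βc ≤ βI)
    (s : Fin L → ℕ) (hs : IsSelection nI k s) :
    ∀ i : Fin k,
      wSeq n nI βI βc (verticalOrdering hL k (horizontalSel L nI k)) i ≤
        wSeq n nI βI βc (verticalOrdering hL k s) i := by
  intro i
  have hnI' : 0 < nI := by omega
  subst hn
  obtain ⟨hle, -, hsum⟩ := hs
  have hcmp (r : ℕ) : ∑ l, min (horizontalSel L nI k l) r ≤ ∑ l, min (s l) r := by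
    rw [sum_min_horizontalSel hkn]
    simpa [hsum] using div_mul_min_le_sum_min hnI' r Finset.univ s hle
  have hk : k ≤ ∑ l, min (horizontalSel L nI k l) k := by
    have h := Nat.div_add_mod k nI
    rw [sum_min_horizontalSel hkn, min_eq_left (Nat.mod_le k nI)]
    rcases le_total nI k with h' | h'
    · rw [min_eq_left h', mul_comm]
      exact h.ge
    · rcases h'.eq_or_lt with rfl | h'
      · simp [Nat.div_self hk1]
      · simp [Nat.mod_eq_of_lt h']
  obtain ⟨r, hr, h₁, h₂⟩ := exists_round s (i.2.trans_le (hk.trans (hcmp k)))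
  obtain ⟨r', hr', h₁', h₂'⟩ := exists_round (horizontalSel L nI k) (i.2.trans_le hk)
  apply wSeq_le_wSeq_of_repCount_le hβIc
  rw [repCount_verticalOrdering hL s i hr h₁ h₂,
    repCount_verticalOrdering hL _ i hr' h₁' h₂']
  by_contra! hlt
  have hmono : ∑ l, min (horizontalSel L nI k l) (r' + 1) ≤
      ∑ l, min (horizontalSel L nI k l) r :=
    Finset.sum_le_sum fun l _ => min_le_min_left _ hlt
  have := hcmp r
  omega
end
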